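/- arXiv:0802.0889 — 2 statements merged into one kernel-verified Lean document; each statement's English description precedes it below -/
import Mathlib

section
/- In SL_2(ℝ), let y(t) = [[1,0],[t,1]], x(t) = [[1,t],[0,1]], and let h(s) = [[s,0],[0,s^{-1}]] for s > 0. Then the semigroup generated by {x(t) : t > 0} ∪ {y(t) : t > 0} ∪ {h(s) : s > 0} consists exactly of the matrices [[a,b],[c,d]] ∈ SL_2(ℝ) with a > 0, d > 0, b ≥ 0, c ≥ 0. -/
open Matrix

/-- The generating set of the totally nonnegative semigroup of `SL₂(ℝ)`:
the matrices `x(t) = [[1,t],[0,1]]`, `y(t) = [[1,0],[t,1]]` for `t > 0` and the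
positive diagonal torus elements `h(s) = [[s,0],[0,s⁻¹]]` for `s > 0`. -/
def SL2Generators : Set (Matrix (Fin 2) (Fin 2) ℝ) :=
  {M | ∃ t : ℝ, 0 < t ∧ M = !![1, t; 0, 1]} ∪
  {M | ∃ t : ℝ, 0 < t ∧ M = !![1, 0; t, 1]} ∪
  {M | ∃ s : ℝ, 0 < s ∧ M = !![s, 0; 0, s⁻¹]}

theorem upper_mem (t : ℝ) (ht : 0 ≤ t) :
    !![1, t; 0, 1] ∈ Subsemigroup.closure SL2Generators := by
  apply Subsemigroup.subset_closure
  rcases ht.eq_or_lt with h | h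
  · subst h
    exact Or.inr ⟨1, one_pos, by simp⟩
  · exact Or.inl (Or.inl ⟨t, h, rfl⟩)

theorem lower_mem (t : ℝ) (ht : 0 ≤ t) :
    !![1, 0; t, 1] ∈ Subsemigroup.closure SL2Generators := by
  apply Subsemigroup.subset_closure
  rcases ht.eq_or_lt with h | h
  · subst h
    exact Or.inr ⟨1, one_pos, by simp⟩
  · exact Or.inl (Or.inr ⟨t, h, rfl⟩)

theorem sl2_semigroup_description :
    (Subsemigroup.closure SL2Generators : Set (Matrix (Fin 2) (Fin 2) ℝ)) =
      {A | A.det = 1 ∧ 0 < A 0 0 ∧ 0 < A 1 1 ∧ 0 ≤ A 0 1 ∧ 0 ≤ A 1 0} := by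
  ext A
  constructor
  · intro hA
    have hA' : A ∈ Subsemigroup.closure SL2Generators := hA
    induction hA' using Subsemigroup.closure_induction with
    | mem M hM =>
      rcases hM with (⟨t, ht, rfl⟩ | ⟨t, ht, rfl⟩) | ⟨s, hs, rfl⟩
      · simp [Matrix.det_fin_two, ht.le]
      · simp [Matrix.det_fin_two, ht.le]
      · simp [Matrix.det_fin_two, hs, hs.ne']
    | mul M N hM hN ihM ihN =>
      obtain ⟨h1, h2, h3, h4, h5⟩ := ihM hM
      obtain ⟨k1, k2, k3, k4, k5⟩ := ihN hN
      refine ⟨by rw [Matrix.det_mul, h1, k1, one_mul], ?_, ?_, ?_, ?_⟩ <;>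
        simp only [Matrix.mul_apply, Fin.sum_univ_two] <;> positivity
  · rintro ⟨h1, h2, h3, h4, h5⟩
    have key : A = !![1, 0; A 1 0 / A 0 0, 1] * !![A 0 0, 0; 0, (A 0 0)⁻¹] *
        !![1, A 0 1 / A 0 0; 0, 1] := by
      rw [Matrix.det_fin_two] at h1
      have h0 := h2.ne'
      have h6 : A 1 1 = A 1 0 * (A 0 1 / A 0 0) + (A 0 0)⁻¹ := by
        field_simp
        linarith
      ext i j
      fin_cases i <;> fin_cases j <;>
        simp [Matrix.mul_apply, Fin.sum_univ_two, h0, mul_div_cancel₀]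
      exact h6
    rw [key]
    exact mul_mem (mul_mem (lower_mem _ (div_nonneg h5 h2.le))
      (Subsemigroup.subset_closure (Or.inr ⟨A 0 0, h2, rfl⟩)))
      (upper_mem _ (div_nonneg h4 h2.le))
end

section
/- Let W be a finite Coxeter group with simple reflections S, and let σ be an automorphism of the Coxeter diagram such that no two vertices in the same σ-orbit are adjacent. For each σ-orbit ō let s_ō = Π_{i ∈ ō} s_i (the product of the commuting simple reflections in the orbit). Then the fixed subgroup W^σ is a Coxeter group with simple reflections {s_ō}, and for every w ∈ W^σ with reduced word s_{ō_1} ⋯ s_{ō_m} in W^σ, the length of w in W equals Σ_{k=1}^m |ō_k|. -/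
/-- The fixed-point subgroup of a group automorphism. -/
def fixedSubgroup {W : Type*} [Group W] (τ : W ≃* W) : Subgroup W where
  carrier := {w | τ w = w}
  one_mem' := by simp
  mul_mem' := by
    intro a b ha hb
    simp only [Set.mem_setOf_eq, map_mul] at *
    rw [ha, hb]
  inv_mem' := by
    intro a ha
    simp only [Set.mem_setOf_eq, map_inv] at *
    rw [ha]

namespace FoldingAux
universe u v
variable {B : Type u} {W : Type v} [Group W] {M : CoxeterMatrix B} (cs : CoxeterSystem M W)

noncomputable def rvec (M : CoxeterMatrix B) (i k : B) : ℝ := 2 * Real.cos (Real.pi / (M i k : ℝ))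

noncomputable def refl (M : CoxeterMatrix B) (i : B) : Function.End (B → ℝ) :=
  fun f k => f k + f i * rvec M i k

lemma rvec_self (i : B) : rvec M i i = -2 := by
  simp [rvec]

lemma rvec_symm (i j : B) : rvec M i j = rvec M j i := by
  simp [rvec, M.symmetric i j]

lemma refl_pow (i j : B) (hs : Real.sin (Real.pi / (M i j : ℝ)) ≠ 0) (k : ℕ) (f : B → ℝ) :
    ((refl M i * refl M j) ^ k) f = fun b => f b
      + (f i * Real.sin (k * (Real.pi / (M i j : ℝ))) ^ 2
        + f j * Real.sin (k * (Real.pi / (M i j : ℝ))) * Real.sin ((k + 1) * (Real.pi / (M i j : ℝ))))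
          / Real.sin (Real.pi / (M i j : ℝ)) ^ 2 * rvec M i b
      + (f i * Real.sin (k * (Real.pi / (M i j : ℝ))) * Real.sin ((k - 1) * (Real.pi / (M i j : ℝ)))
        + f j * Real.sin (k * (Real.pi / (M i j : ℝ))) ^ 2)
          / Real.sin (Real.pi / (M i j : ℝ)) ^ 2 * rvec M j b := by
  have hij : rvec M i j = 2 * Real.cos (Real.pi / (M i j : ℝ)) := rfl
  have hji : rvec M j i = 2 * Real.cos (Real.pi / (M i j : ℝ)) := by rw [rvec_symm]; rfl
  have hii := rvec_self (M := M) i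
  have hjj := rvec_self (M := M) j
  set θ := Real.pi / (M i j : ℝ) with hθ
  induction k with
  | zero => funext b; simp only [pow_zero]; change f b = _; simp
  | succ k ih =>
    rw [pow_succ']
    change refl M i (refl M j (((refl M i * refl M j) ^ k) f)) = _
    rw [ih]
    funext b
    simp only [refl, hij, hji, hii, hjj]
    push_cast
    have e1 : ((k : ℝ) + 1 + 1) * θ = k * θ + θ + θ := by ring
    have e2 : ((k : ℝ) + 1) * θ = k * θ + θ := by ring
    have e3 : ((k : ℝ) + 1 - 1) * θ = k * θ := by ring
    have e4 : ((k : ℝ) - 1) * θ = k * θ - θ := by ring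
    rw [e1, e3, e2, e4]
    simp only [Real.sin_add, Real.sin_sub, Real.cos_add]
    have h1 := Real.sin_sq_add_cos_sq θ
    have h2 := Real.sin_sq_add_cos_sq (k * θ)
    generalize Real.sin (k * θ) = S at *
    generalize Real.cos (k * θ) = C at *
    generalize Real.sin θ = s at *
    generalize Real.cos θ = c at *
    have hc : c ^ 2 = 1 - s ^ 2 := by linarith
    have hC : C ^ 2 = 1 - S ^ 2 := by linarith
    generalize rvec M i b = vi
    generalize rvec M j b = vj
    generalize f i = x
    generalize f j = y
    generalize f b = z
    field_simp
    have hc3 : c ^ 3 = c * (1 - s ^ 2) := by rw [← hc]; ring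
    ring_nf
    simp only [hc, hC, hc3]
    ring

lemma refl_liftable : M.IsLiftable (refl M) := by
  intro i j
  by_cases hij : i = j
  · subst hij
    rw [M.diagonal, pow_one]
    funext f b
    change refl M i (refl M i f) b = f b
    simp only [refl, rvec_self]
    ring
  by_cases h0 : M i j = 0
  · rw [h0, pow_zero]
  have h1 : M i j ≠ 1 := M.off_diagonal i j hij
  have h2 : (2 : ℝ) ≤ (M i j : ℝ) := by
    have : 2 ≤ M i j := by omega
    exact_mod_cast this
  have hs : Real.sin (Real.pi / (M i j : ℝ)) ≠ 0 := by
    apply ne_of_gt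
    apply Real.sin_pos_of_pos_of_lt_pi
    · have := Real.pi_pos; positivity
    · rw [div_lt_iff₀ (by linarith)]
      nlinarith [Real.pi_pos]
  have hm : (M i j : ℝ) * (Real.pi / (M i j : ℝ)) = Real.pi := by field_simp
  funext f
  rw [refl_pow i j hs]
  simp [hm]
  rfl

lemma simple_inj : Function.Injective cs.simple := by
  intro i j h
  by_contra hij
  have h1 : M i j ≠ 1 := M.off_diagonal i j hij
  have h2 : refl M i = refl M j := by
    rw [← cs.lift_apply_simple refl_liftable i, ← cs.lift_apply_simple refl_liftable j, h]
  have h3 := congrFun (congrFun h2 (fun _ => 1)) i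
  simp only [refl, rvec_self] at h3
  have h4 : 0 ≤ rvec M j i := by
    rw [rvec_symm, rvec]
    apply mul_nonneg (by norm_num)
    have := Real.pi_pos
    apply Real.cos_nonneg_of_neg_pi_div_two_le_of_le
    · have : 0 ≤ Real.pi / (M i j : ℝ) := by positivity
      linarith
    · rcases Nat.eq_zero_or_pos (M i j) with h0 | h0
      · simp [h0]; positivity
      · apply div_le_div_of_nonneg_left <;> try positivity
        have : 2 ≤ M i j := by omega
        exact_mod_cast this
  linarith

open Classical in
noncomputable def pf (i : B) : Function.End (W × ZMod 2) :=
  fun p => (cs.simple i * p.1 * cs.simple i, p.2 + if p.1 = cs.simple i then 1 else 0)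

open Classical in
lemma pf_pow (i j : B) (k : ℕ) (t : W) (e : ZMod 2) :
    ((pf cs i * pf cs j) ^ k) (t, e) =
      ((cs.simple i * cs.simple j) ^ k * t * ((cs.simple i * cs.simple j) ^ k)⁻¹,
        e + ∑ r ∈ Finset.range (2 * k),
          if t = ((cs.simple i * cs.simple j) ^ r)⁻¹ * cs.simple j then 1 else 0) := by
  have hi := cs.simple_mul_simple_self i
  have hj := cs.simple_mul_simple_self j
  have hi' := cs.inv_simple i
  have hj' := cs.inv_simple j
  set a := cs.simple i with ha
  set b := cs.simple j with hb
  have key : ∀ k : ℕ, b * (a * b) ^ k = ((a * b) ^ k)⁻¹ * b := by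
    intro k
    rw [← inv_pow, mul_inv_rev, hi', hj', ← mul_pow_mul]
  have conj : ∀ (k : ℕ) (y : W), (a * b) ^ k * t * ((a * b) ^ k)⁻¹ = y ↔
      t = ((a * b) ^ k)⁻¹ * y * (a * b) ^ k := by
    intro k y
    constructor
    · rintro rfl; group
    · intro h; rw [h]; group
  induction k with
  | zero => simp only [pow_zero]; change (t, e) = _; simp
  | succ k ih =>
    rw [pow_succ']
    change pf cs i (pf cs j (((pf cs i * pf cs j) ^ k) (t, e))) = _
    rw [ih]
    simp only [pf, ← ha, ← hb]
    rw [show 2 * (k + 1) = 2 * k + 1 + 1 by ring, Finset.sum_range_succ, Finset.sum_range_succ]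
    have e1 : ((a * b) ^ k * t * ((a * b) ^ k)⁻¹ = b) ↔ (t = ((a * b) ^ (2 * k))⁻¹ * b) := by
      rw [conj, mul_assoc, key, ← mul_assoc, ← mul_inv_rev, ← pow_add, two_mul]
    have e2 : (b * ((a * b) ^ k * t * ((a * b) ^ k)⁻¹) * b = a) ↔
        (t = ((a * b) ^ (2 * k + 1))⁻¹ * b) := by
      have : (b * ((a * b) ^ k * t * ((a * b) ^ k)⁻¹) * b = a) ↔
          ((a * b) ^ k * t * ((a * b) ^ k)⁻¹ = (a * b)⁻¹ * b) := by
        rw [mul_inv_rev, hi', hj', ← eq_mul_inv_iff_mul_eq, ← eq_inv_mul_iff_mul_eq, hj', ← mul_assoc b a b]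
      rw [this, conj, mul_assoc, mul_assoc, key, ← mul_assoc, ← mul_assoc, ← mul_inv_rev,
        ← mul_inv_rev, ← pow_succ', ← pow_add]
      congr! 4
      omega
    ext
    · simp only [pow_succ', mul_inv_rev, hi', hj']
      simp only [mul_assoc]
    · simp only [e1, e2]
      ring

lemma pf_liftable : M.IsLiftable (pf cs) := by
  classical
  intro i j
  funext ⟨t, e⟩
  rw [pf_pow, two_mul, Finset.sum_range_add]
  simp only [pow_add, cs.simple_mul_simple_pow, one_mul]
  rw [CharTwo.add_self_eq_zero]
  simp
  rfl

/-- The parity cocycle. -/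
noncomputable def N (w t : W) : ZMod 2 := (cs.lift ⟨pf cs, pf_liftable cs⟩ w (t, 0)).2

lemma lift_pf (w t : W) (e : ZMod 2) :
    cs.lift ⟨pf cs, pf_liftable cs⟩ w (t, e) = (w * t * w⁻¹, e + N cs w t) := by
  have main : ∀ w : W, ∀ t, ∀ e, cs.lift ⟨pf cs, pf_liftable cs⟩ w (t, e) =
      (w * t * w⁻¹, e + (cs.lift ⟨pf cs, pf_liftable cs⟩ w (t, 0)).2) := by
    intro w
    induction w using cs.simple_induction_left with
    | one =>
      intro t e
      rw [map_one]
      change (t, e) = (_, e + (0 : ZMod 2))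
      simp
    | mul_simple_left w i ih =>
      intro t e
      rw [map_mul, cs.lift_apply_simple]
      change pf cs i (cs.lift ⟨pf cs, pf_liftable cs⟩ w (t, e)) =
        (_, e + (pf cs i (cs.lift ⟨pf cs, pf_liftable cs⟩ w (t, 0))).2)
      rw [ih t e, ih t 0]
      simp only [pf, mul_inv_rev, cs.inv_simple]
      ext
      · simp only [mul_assoc]
      · simp only [zero_add, add_assoc]
  exact main w t e

lemma N_mul (u v t : W) : N cs (u * v) t = N cs v t + N cs u (v * t * v⁻¹) := by
  have : cs.lift ⟨pf cs, pf_liftable cs⟩ (u * v) (t, 0) =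
      cs.lift ⟨pf cs, pf_liftable cs⟩ u (cs.lift ⟨pf cs, pf_liftable cs⟩ v (t, 0)) := by
    rw [map_mul]; rfl
  rw [lift_pf, lift_pf, lift_pf] at this
  simpa using congrArg Prod.snd this

open Classical in
lemma N_simple (i : B) (t : W) : N cs (cs.simple i) t = if t = cs.simple i then 1 else 0 := by
  rw [N, cs.lift_apply_simple]
  simp [pf]

lemma N_one (t : W) : N cs 1 t = 0 := by
  rw [N, map_one]; rfl

lemma N_word {ω : List B} {t : W} (h : N cs (cs.wordProd ω) t ≠ 0) :
    ∃ ω₁ j ω₂, ω = ω₁ ++ j :: ω₂ ∧ t = (cs.wordProd ω₂)⁻¹ * cs.simple j * cs.wordProd ω₂ := by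
  classical
  induction ω with
  | nil => simp [N_one] at h
  | cons i ω ih =>
    rw [cs.wordProd_cons, N_mul] at h
    by_cases h1 : N cs (cs.wordProd ω) t = 0
    · rw [h1, zero_add, N_simple] at h
      have h2 : cs.wordProd ω * t * (cs.wordProd ω)⁻¹ = cs.simple i := by
        by_contra h3
        exact h (if_neg h3)
      refine ⟨[], i, ω, rfl, ?_⟩
      rw [← h2]; group
    · obtain ⟨ω₁, j, ω₂, rfl, h3⟩ := ih h1
      exact ⟨i :: ω₁, j, ω₂, rfl, h3⟩

lemma length_lt_of_N {w t : W} (h : N cs w t ≠ 0) : cs.length (w * t) < cs.length w := by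
  obtain ⟨ω, hω, rfl⟩ := cs.exists_isReduced w
  obtain ⟨ω₁, j, ω₂, rfl, rfl⟩ := N_word cs h
  rw [hω.eq]
  have : cs.wordProd (ω₁ ++ j :: ω₂) * ((cs.wordProd ω₂)⁻¹ * cs.simple j * cs.wordProd ω₂) =
      cs.wordProd (ω₁ ++ ω₂) := by
    rw [cs.wordProd_append, cs.wordProd_cons, cs.wordProd_append]
    simp [mul_assoc]
  rw [this]
  refine (cs.length_wordProd_le _).trans_lt ?_
  simp

lemma N_simple_iff (w : W) (i : B) :
    N cs w (cs.simple i) ≠ 0 ↔ cs.length (w * cs.simple i) < cs.length w := by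
  refine ⟨length_lt_of_N cs, fun h h0 => ?_⟩
  have h1 : N cs (w * cs.simple i) (cs.simple i) ≠ 0 := by
    rw [N_mul, N_simple]
    simp [h0]
  have := length_lt_of_N cs h1
  rw [cs.simple_mul_simple_cancel_right] at this
  omega

end FoldingAux

namespace FoldingAux
open CoxeterSystem

/-- Abstract folding data: generating involutions with a weighted length function satisfying
the exchange condition. -/
structure Fold {G O : Type*} [Group G] (t : O → G) (L : G → ℕ) (c : O → ℕ) : Prop where
  sq : ∀ o, t o * t o = 1
  inj : Function.Injective t
  cpos : ∀ o, 0 < c o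
  L1 : L 1 = 0
  Linv : ∀ g, L g⁻¹ = L g
  step : ∀ g o, L (g * t o) = L g + c o ∨ L (g * t o) + c o = L g
  exch : ∀ (ω : List O) o, L ((ω.map t).prod * t o) < L (ω.map t).prod →
    ∃ ω₁ o' ω₂, ω = ω₁ ++ o' :: ω₂ ∧
      (ω.map t).prod * t o = ((ω₁ ++ ω₂).map t).prod ∧ c o' = c o
  gen : ∀ g, ∃ ω : List O, (ω.map t).prod = g

namespace Fold
variable {G O : Type*} [Group G] {t : O → G} {L : G → ℕ} {c : O → ℕ} (F : Fold t L c)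
include F

lemma L_le (g : G) (ω : List O) : L (g * (ω.map t).prod) ≤ L g + (ω.map c).sum := by
  induction ω using List.reverseRecOn with
  | nil => simp
  | append_singleton ω o ih =>
    simp only [List.map_append, List.prod_append, List.sum_append, List.map_cons, List.map_nil,
      List.prod_singleton, List.sum_singleton, ← mul_assoc]
    rcases F.step (g * (ω.map t).prod) o with h | h <;> omega

lemma L_le' (ω : List O) : L (ω.map t).prod ≤ (ω.map c).sum := by
  have := F.L_le 1 ω
  rwa [one_mul, F.L1, zero_add] at this

lemma exists_add (ω : List O) : ∃ ω' : List O, ω'.Sublist ω ∧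
    L (ω'.map t).prod = (ω'.map c).sum ∧ (ω'.map t).prod = (ω.map t).prod := by
  induction ω using List.reverseRecOn with
  | nil => exact ⟨[], by simp, by simp [F.L1], rfl⟩
  | append_singleton ω o ih =>
    obtain ⟨ω', h1, h2, h3⟩ := ih
    by_cases h : L ((ω'.map t).prod * t o) < L (ω'.map t).prod
    · obtain ⟨ω₁, o', ω₂, rfl, h5, h6⟩ := F.exch ω' o h
      refine ⟨ω₁ ++ ω₂, ?_, ?_, ?_⟩
      · refine List.Sublist.trans ?_ (h1.trans (List.sublist_append_left _ _))
        simp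
      · rw [← h5]
        have := F.step ((ω₁ ++ o' :: ω₂).map t).prod o
        simp only [List.map_append, List.map_cons, List.sum_append, List.sum_cons] at *
        omega
      · rw [← h5, h3]; simp
    · refine ⟨ω' ++ [o], h1.append (List.Sublist.refl _), ?_, by simp [h3]⟩
      have := F.step (ω'.map t).prod o
      have := F.cpos o
      simp only [List.map_append, List.map_cons, List.sum_append, List.sum_cons, List.prod_append,
        List.map_nil, List.prod_singleton, List.sum_nil] at *
      omega

lemma eq_one_of_L {g : G} (h : L g = 0) : g = 1 := by
  obtain ⟨ω, rfl⟩ := F.gen g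
  obtain ⟨ω', h1, h2, h3⟩ := F.exists_add ω
  rw [← h3] at h ⊢
  rw [h] at h2
  cases ω' with
  | nil => simp
  | cons o ω' =>
    have := F.cpos o
    simp at h2; omega

lemma claimA_aux (J : Set O) (g : G) (hg : ∀ o ∈ J, L (g * t o) < L g) (ω : List O)
    (hJ : ∀ o ∈ ω, o ∈ J) (hω : L (ω.map t).prod = (ω.map c).sum) :
    ∃ v : List O, g = (v.map t).prod * (ω.map t).prod ∧ (v.map c).sum + (ω.map c).sum = L g := by
  induction ω using List.reverseRecOn with
  | nil =>
    obtain ⟨ω, rfl⟩ := F.gen g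
    obtain ⟨ω', h1, h2, h3⟩ := F.exists_add ω
    exact ⟨ω', by simp [h3], by simp [← h2, h3]⟩
  | append_singleton ω s ih =>
    have hs := F.step (ω.map t).prod s
    have hl := F.L_le' ω
    have hc := F.cpos s
    have hω' := hω
    simp only [List.map_append, List.map_cons, List.sum_append, List.sum_cons, List.prod_append,
      List.map_nil, List.prod_singleton, List.sum_nil] at hω'
    obtain ⟨v, h1, h2⟩ := ih (fun o ho => hJ o (by simp [ho])) (by omega)
    have h3 : g = ((v ++ ω).map t).prod := by simp [h1]
    have h4 := hg s (hJ s (by simp))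
    have h4' := h4
    rw [h3] at h4
    obtain ⟨α, o', β, h5, h6, h7⟩ := F.exch _ s h4
    rw [← h3] at h6
    have hgs : g = g * t s * t s := by rw [mul_assoc, F.sq, mul_one]
    rcases List.append_eq_append_iff.mp h5 with ⟨as, h8, h9⟩ | ⟨bs, h8, h9⟩
    · exfalso
      subst h8 h9
      have h10 : ((as ++ o' :: β).map t).prod * t s = ((as ++ β).map t).prod := by
        rw [h1] at h6
        simp only [List.map_append, List.prod_append, mul_assoc] at h6 ⊢
        exact mul_left_cancel h6
      have h11 := F.L_le' (as ++ β)
      rw [← h10] at h11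
      simp only [List.map_append, List.map_cons, List.sum_append, List.sum_cons] at *
      omega
    · cases bs with
      | nil =>
        exfalso
        simp only [List.nil_append] at h9
        simp only [List.append_nil] at h8
        subst h8
        subst h9
        have h10 : ((o' :: β).map t).prod * t s = (β.map t).prod := by
          rw [h1] at h6
          simp only [List.map_append, List.prod_append, mul_assoc] at h6 ⊢
          exact mul_left_cancel h6
        have h11 := F.L_le' β
        rw [← h10] at h11
        simp only [List.map_append, List.map_cons, List.sum_append, List.sum_cons] at *
        omega
      | cons b bs =>
        simp only [List.cons_append, List.cons.injEq] at h9
        obtain ⟨rfl, rfl⟩ := h9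
        subst h8
        refine ⟨α ++ bs, ?_, ?_⟩
        · rw [hgs, h6]; simp [mul_assoc]
        · simp only [List.map_append, List.map_cons, List.sum_append, List.sum_cons, List.map_nil,
            List.sum_nil] at *
          omega

lemma prod_reverse (ω : List O) : (ω.reverse.map t).prod = ((ω.map t).prod)⁻¹ := by
  induction ω with
  | nil => simp
  | cons o ω ih =>
    have : (t o)⁻¹ = t o := inv_eq_of_mul_eq_one_left (F.sq o)
    rw [List.reverse_cons, List.map_append, List.prod_append, ih]
    simp [this]

lemma claimA (J : Set O) (g : G) (hg : ∀ o ∈ J, L (g * t o) < L g) (ω : List O)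
    (hJ : ∀ o ∈ ω, o ∈ J) : L (g * (ω.map t).prod) + L (ω.map t).prod = L g := by
  obtain ⟨ω', h1, h2, h3⟩ := F.exists_add ω.reverse
  obtain ⟨v, h4, h5⟩ := F.claimA_aux J g hg ω'
    (fun o ho => hJ o (by simpa using h1.subset ho)) h2
  rw [h3, F.prod_reverse] at h4 h2
  rw [F.Linv] at h2
  have h6 : g * (ω.map t).prod = (v.map t).prod := by
    rw [h4]; simp
  have h7 := F.L_le' v
  have h8 : L g ≤ L (g * (ω.map t).prod) + (ω'.map c).sum := by
    have := F.L_le (g * (ω.map t).prod) ω'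
    rwa [h3, F.prod_reverse, mul_inv_cancel_right] at this
  rw [h6] at h8 ⊢
  omega

lemma top_unique (J : Set O) (g : G) (hg : ∀ o ∈ J, L (g * t o) < L g) (ω : List O)
    (hJ : ∀ o ∈ ω, o ∈ J)
    (hg' : ∀ o ∈ J, L (g * (ω.map t).prod * t o) < L (g * (ω.map t).prod)) :
    (ω.map t).prod = 1 := by
  have h1 := F.claimA J g hg ω hJ
  have h2 := F.claimA J _ hg' ω.reverse (by simpa using hJ)
  rw [F.prod_reverse, mul_inv_cancel_right] at h2
  exact F.eq_one_of_L (by omega)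

lemma mem_alt {x y z : O} {k : ℕ} (h : z ∈ alternatingWord x y k) : z = x ∨ z = y := by
  induction k generalizing x y with
  | zero => simp [alternatingWord] at h
  | succ k ih =>
    rw [alternatingWord_succ] at h
    simp only [List.concat_eq_append, List.mem_append, List.mem_singleton] at h
    rcases h with h | h
    · exact (ih h).symm
    · exact Or.inr h

lemma alt_quot (x y : O) (k : ℕ) :
    (((alternatingWord y x k).map t).prod)⁻¹ * ((alternatingWord x y k).map t).prod =
      (t x * t y) ^ k := by
  have hx : (t x)⁻¹ = t x := inv_eq_of_mul_eq_one_left (F.sq x)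
  have hy : (t y)⁻¹ = t y := inv_eq_of_mul_eq_one_left (F.sq y)
  induction k with
  | zero => simp [alternatingWord]
  | succ k ih =>
    have ih' := congrArg (·⁻¹) ih
    simp only [mul_inv_rev, inv_inv, ← inv_pow, hx, hy] at ih'
    rw [alternatingWord_succ, alternatingWord_succ]
    simp only [List.concat_eq_append, List.map_append, List.prod_append, List.map_cons,
      List.map_nil, List.prod_singleton, mul_inv_rev, hx]
    rw [mul_assoc, ← mul_assoc _ _ (t y), ih', ← mul_assoc, ← mul_pow_mul, mul_assoc, ← pow_succ]

lemma dihedral_step (g : G) (x y : O) (k : ℕ) (hk : k ≠ 0)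
    (hm : orderOf (t x * t y) = 0 ∨ k + 1 ≤ orderOf (t x * t y))
    (h1 : L (g * ((alternatingWord x y k).map t).prod) =
      L g + ((alternatingWord x y k).map c).sum)
    (h2 : L (g * ((alternatingWord y x k).map t).prod) =
      L g + ((alternatingWord y x k).map c).sum) :
    L (g * ((alternatingWord y x (k + 1)).map t).prod) =
      L g + ((alternatingWord y x (k + 1)).map c).sum := by
  obtain ⟨n, rfl⟩ := Nat.exists_eq_add_one_of_ne_zero hk
  have hlast : ∀ x y : O, L (g * ((alternatingWord x y (n + 1)).map t).prod) =
      L g + ((alternatingWord x y (n + 1)).map c).sum →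
      L (g * ((alternatingWord x y (n + 1)).map t).prod * t y) <
        L (g * ((alternatingWord x y (n + 1)).map t).prod) := by
    intro x y h
    have h3 := F.L_le g (alternatingWord y x n)
    have h4 := F.cpos y
    rw [h]
    rw [alternatingWord_succ]
    simp only [List.concat_eq_append, List.map_append, List.prod_append, List.map_cons,
      List.map_nil, List.prod_singleton, List.sum_append, List.sum_singleton, mul_assoc, F.sq,
      mul_one]
    omega
  have e1 : ((alternatingWord y x ((n + 1) + 1)).map t).prod =
      ((alternatingWord x y (n + 1)).map t).prod * t x := by
    rw [alternatingWord_succ]; simp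
  have e2 : ((alternatingWord y x ((n + 1) + 1)).map c).sum =
      ((alternatingWord x y (n + 1)).map c).sum + c x := by
    rw [alternatingWord_succ]; simp
  rw [e1, e2, ← mul_assoc]
  rcases F.step (g * ((alternatingWord x y (n + 1)).map t).prod) x with h | h
  · omega
  exfalso
  have hcx := F.cpos x
  have hcy := F.cpos y
  have hW : ∀ o ∈ ({x, y} : Set O), L (g * ((alternatingWord x y (n + 1)).map t).prod * t o) <
      L (g * ((alternatingWord x y (n + 1)).map t).prod) := by
    intro o ho
    rcases ho with rfl | rfl
    · omega
    · exact hlast _ _ h1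
  have hquot : ∀ k : ℕ, g * ((alternatingWord x y (n + 1)).map t).prod *
      (((alternatingWord x y (n + 1)).reverse ++ alternatingWord y x k).map t).prod =
      g * ((alternatingWord y x k).map t).prod := by
    intro k
    rw [List.map_append, List.prod_append, F.prod_reverse]
    group
  have hmem : ∀ k : ℕ, ∀ o ∈ (alternatingWord x y (n + 1)).reverse ++ alternatingWord y x k,
      o ∈ ({x, y} : Set O) := by
    intro k o ho
    simp only [List.mem_append, List.mem_reverse] at ho
    rcases ho with ho | ho
    · exact mem_alt F ho
    · exact (mem_alt F ho).symm
  have hV : ∀ o ∈ ({x, y} : Set O), L (g * ((alternatingWord y x (n + 1)).map t).prod * t o) <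
      L (g * ((alternatingWord y x (n + 1)).map t).prod) := by
    intro o ho
    rcases ho with rfl | rfl
    · exact hlast _ _ h2
    · rcases F.step (g * ((alternatingWord o x (n + 1)).map t).prod) o with h3 | h3
      · exfalso
        have h4 := F.claimA _ _ hW
          ((alternatingWord x o (n + 1)).reverse ++ (alternatingWord o x (n + 1) ++ [o])) (by
            intro z hz
            rw [← List.append_assoc, List.mem_append] at hz
            rcases hz with hz | hz
            · exact hmem _ _ hz
            · simp at hz; simp [hz])
        rw [← List.append_assoc, List.map_append, List.prod_append, ← mul_assoc, hquot] at h4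
        simp only [List.map_cons, List.map_nil, List.prod_singleton] at h4
        have e3 : ((alternatingWord x o ((n + 1) + 1)).map c).sum =
            ((alternatingWord o x (n + 1)).map c).sum + c o := by
          rw [alternatingWord_succ]; simp
        rw [alternatingWord_succ'] at e3
        simp only [List.map_cons, List.sum_cons] at e3
        have := F.cpos (if Even (n + 1) then o else x)
        omega
      · omega
  have h5 := F.top_unique _ _ hW _ (hmem (n + 1)) (by rw [hquot]; exact hV)
  rw [List.map_append, List.prod_append, F.prod_reverse] at h5
  have h6 := F.alt_quot y x (n + 1)
  rw [h5] at h6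
  have h7 : (t x * t y) ^ (n + 1) = 1 := by
    have h8 : t x * t y = (t y * t x)⁻¹ := by
      rw [mul_inv_rev, inv_eq_of_mul_eq_one_left (F.sq x), inv_eq_of_mul_eq_one_left (F.sq y)]
    rw [h8, inv_pow, ← h6, inv_one]
  have h9 := orderOf_dvd_of_pow_eq_one h7
  rcases hm with hm | hm
  · rw [hm] at h9
    simp at h9
  · have := Nat.le_of_dvd (by omega) h9
    omega

lemma order_symm (x y : O) : orderOf (t x * t y) = orderOf (t y * t x) := by
  rw [← orderOf_inv, mul_inv_rev, inv_eq_of_mul_eq_one_left (F.sq x),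
    inv_eq_of_mul_eq_one_left (F.sq y)]

lemma dihedral (g : G) (x y : O) (hx : L g < L (g * t x)) (hy : L g < L (g * t y)) (k : ℕ)
    (hm : orderOf (t x * t y) = 0 ∨ k ≤ orderOf (t x * t y)) :
    L (g * ((alternatingWord x y k).map t).prod) =
      L g + ((alternatingWord x y k).map c).sum ∧
    L (g * ((alternatingWord y x k).map t).prod) =
      L g + ((alternatingWord y x k).map c).sum := by
  induction k with
  | zero => simp [alternatingWord]
  | succ k ih =>
    obtain ⟨h1, h2⟩ := ih (by omega)
    by_cases hk : k = 0
    · subst hk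
      have := F.step g x
      have := F.step g y
      have := F.cpos x
      have := F.cpos y
      simp only [alternatingWord, List.concat_eq_append, List.nil_append, List.map_cons,
        List.map_nil, List.prod_singleton, List.sum_singleton]
      omega
    · exact ⟨F.dihedral_step g y x k hk (by rwa [F.order_symm]) h2 h1,
        F.dihedral_step g x y k hk hm h1 h2⟩

/-- The Coxeter matrix of the folded system. -/
noncomputable def mat : CoxeterMatrix O where
  M := fun o o' => orderOf (t o * t o')
  isSymm := by
    ext x y
    exact F.order_symm y x
  diagonal := by
    intro o
    rw [F.sq, orderOf_one]
  off_diagonal := by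
    intro x y hxy h
    rw [orderOf_eq_one_iff] at h
    apply hxy
    apply F.inj
    rw [eq_inv_of_mul_eq_one_left h, inv_eq_of_mul_eq_one_left (F.sq y)]

lemma mat_apply (x y : O) : F.mat.M x y = orderOf (t x * t y) := rfl

lemma liftable : F.mat.IsLiftable t := fun x y => by
  rw [mat_apply, pow_orderOf_eq_one]

lemma strip {H : Type*} [Group H] {M : CoxeterMatrix O} (cs : CoxeterSystem M H) (n : ℕ) :
    ∀ (w : H) (x y : O), cs.length w = n → ¬ cs.IsRightDescent w x →
    ∃ k v, w = v * cs.wordProd (alternatingWord x y k) ∧ cs.length w = cs.length v + k ∧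
      ¬ cs.IsRightDescent v x ∧ ¬ cs.IsRightDescent v y := by
  induction n with
  | zero =>
    intro w x y h hx
    rw [cs.length_eq_zero_iff] at h
    subst h
    exact ⟨0, 1, by simp [alternatingWord], by simp, cs.not_isRightDescent_one _,
      cs.not_isRightDescent_one _⟩
  | succ n ih =>
    intro w x y h hx
    by_cases hy : cs.IsRightDescent w y
    · have h1 := cs.isRightDescent_iff.mp hy
      have h2 := cs.isRightDescent_iff_not_isRightDescent_mul.mp hy
      obtain ⟨k, v, h3, h4, h5, h6⟩ := ih (w * cs.simple y) y x (by omega) h2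
      refine ⟨k + 1, v, ?_, by omega, h6, h5⟩
      rw [alternatingWord_succ, cs.wordProd_concat, ← mul_assoc, ← h3,
        cs.simple_mul_simple_cancel_right]
    · exact ⟨0, w, by simp [alternatingWord], by simp, hx, hy⟩

section
variable {H : Type*} [Group H] (cs : CoxeterSystem F.mat H) (φ : H →* G)
  (hφ : ∀ o, φ (cs.simple o) = t o)
include hφ

lemma map_word (ω : List O) : φ (cs.wordProd ω) = (ω.map t).prod := by
  rw [wordProd, map_list_prod, List.map_map]
  congr 2
  funext o
  exact hφ o

lemma ascent (n : ℕ) : ∀ (w : H) (o : O), cs.length w = n → ¬ cs.IsRightDescent w o →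
    L (φ w) < L (φ w * t o) := by
  induction n using Nat.strong_induction_on with
  | _ n ih =>
  intro w o hn ho
  by_cases hw : w = 1
  · subst hw
    have := F.step 1 o
    have := F.cpos o
    rw [map_one, F.L1] at *
    omega
  obtain ⟨o', ho'⟩ := cs.exists_rightDescent_of_ne_one hw
  obtain ⟨k, v, h1, h2, h3, h4⟩ := strip F cs n w o o' hn ho
  have hk : k ≠ 0 := by
    rintro rfl
    simp only [alternatingWord, cs.wordProd_nil, mul_one] at h1
    subst h1
    exact h4 ho'
  have h5 := cs.not_isRightDescent_iff.mp ho
  have h6 : w * cs.simple o = v * cs.wordProd (alternatingWord o' o (k + 1)) := by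
    rw [alternatingWord_succ, cs.wordProd_concat, ← mul_assoc, ← h1]
  have h7 : cs.IsReduced (alternatingWord o' o (k + 1)) := by
    have h8 := cs.length_mul_le v (cs.wordProd (alternatingWord o' o (k + 1)))
    have h9 := cs.length_wordProd_le (alternatingWord o' o (k + 1))
    rw [← h6] at h8
    rw [length_alternatingWord] at h9
    rw [CoxeterSystem.IsReduced, length_alternatingWord]
    omega
  have h8 : orderOf (t o' * t o) = 0 ∨ k + 1 ≤ orderOf (t o' * t o) := by
    by_contra hc
    push Not at hc
    exact cs.not_isReduced_alternatingWord o' o (by rw [F.mat_apply]; exact hc.1)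
      (by rw [F.mat_apply]; exact hc.2) h7
  have i1 := ih _ (by omega) v o rfl h3
  have i2 := ih _ (by omega) v o' rfl h4
  have d1 := (F.dihedral (φ v) o' o i2 i1 (k + 1) h8).1
  have d2 := F.L_le (φ v) (alternatingWord o o' k)
  rw [← F.map_word cs φ hφ, ← map_mul] at d1 d2
  rw [← h6] at d1
  rw [← h1] at d2
  rw [map_mul, hφ, alternatingWord_succ] at d1
  have := F.cpos o
  simp at d1
  omega

lemma L_reduced (ω : List O) (hω : cs.IsReduced ω) : L (φ (cs.wordProd ω)) = (ω.map c).sum := by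
  induction ω using List.reverseRecOn with
  | nil => simp [F.L1]
  | append_singleton ω o ih =>
    have h1 : cs.IsReduced ω := by
      have := hω.take ω.length
      simpa using this
    have h2 := ih h1
    have h3 : ¬ cs.IsRightDescent (cs.wordProd ω) o := by
      rw [cs.not_isRightDescent_iff]
      have := hω.eq
      have := h1.eq
      simp only [cs.wordProd_append, cs.wordProd_singleton, List.length_append,
        List.length_singleton] at *
      omega
    have h4 := F.ascent cs φ hφ _ _ o rfl h3
    have h5 := F.step (φ (cs.wordProd ω)) o
    simp only [cs.wordProd_append, cs.wordProd_singleton, map_mul, hφ, List.map_append,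
      List.sum_append, List.map_cons, List.map_nil, List.sum_singleton]
    omega

lemma bij : Function.Bijective φ := by
  constructor
  · rw [injective_iff_map_eq_one]
    intro w hw
    obtain ⟨ω, hω, rfl⟩ := cs.exists_isReduced w
    have := F.L_reduced cs φ hφ ω hω
    rw [hw, F.L1] at this
    cases ω with
    | nil => simp
    | cons o ω =>
      have := F.cpos o
      simp at *
      omega
  · intro g
    obtain ⟨ω, rfl⟩ := F.gen g
    exact ⟨cs.wordProd ω, F.map_word cs φ hφ ω⟩

end

theorem main : ∃ (M' : CoxeterMatrix O) (cs' : CoxeterSystem M' G),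
    (∀ o, cs'.simple o = t o) ∧
    ∀ ω, cs'.IsReduced ω → L (cs'.wordProd ω) = (ω.map c).sum := by
  let cs0 := F.mat.toCoxeterSystem
  let φ := cs0.lift ⟨t, F.liftable⟩
  have hφ : ∀ o, φ (cs0.simple o) = t o := cs0.lift_apply_simple F.liftable
  let e := MulEquiv.ofBijective φ (F.bij cs0 φ hφ)
  have hs : ∀ o, (cs0.map e).simple o = t o := fun o => by
    rw [CoxeterSystem.map_simple]; exact hφ o
  refine ⟨F.mat, cs0.map e, hs, fun ω hω => ?_⟩
  exact F.L_reduced (cs0.map e) (MonoidHom.id G) hs ω hω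

end Fold
end FoldingAux

namespace FoldingAux
universe u v w
variable {B : Type u} {W : Type v} [Group W] {M : CoxeterMatrix B} (cs : CoxeterSystem M W)

lemma commute_wordProd {i : B} {l : List B}
    (h : ∀ j ∈ l, Commute (cs.simple i) (cs.simple j)) :
    Commute (cs.simple i) (cs.wordProd l) := by
  induction l with
  | nil => simp
  | cons a l ih =>
    rw [cs.wordProd_cons]
    exact (h a (by simp)).mul_right (ih fun j hj => h j (by simp [hj]))

lemma N_block {l : List B} (hc : ∀ i ∈ l, ∀ j ∈ l, Commute (cs.simple i) (cs.simple j)) {t : W}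
    (h : N cs (cs.wordProd l) t ≠ 0) : ∃ j ∈ l, t = cs.simple j := by
  obtain ⟨l₁, j, l₂, rfl, h2⟩ := N_word cs h
  refine ⟨j, by simp, ?_⟩
  have : Commute (cs.simple j) (cs.wordProd l₂) :=
    commute_wordProd cs fun k hk => hc j (by simp) k (by simp [hk])
  rw [h2, mul_assoc, this.eq, inv_mul_cancel_left]

lemma N_mul_simple {g : W} {i j : B} (hij : i ≠ j) (hc : Commute (cs.simple i) (cs.simple j)) :
    N cs (g * cs.simple i) (cs.simple j) = N cs g (cs.simple j) := by
  rw [N_mul, N_simple, if_neg (fun h => hij (simple_inj cs h.symm)), zero_add, hc.eq,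
    mul_inv_cancel_right]

lemma length_up {l : List B} (hn : l.Nodup)
    (hc : ∀ i ∈ l, ∀ j ∈ l, Commute (cs.simple i) (cs.simple j)) :
    ∀ g : W, (∀ i ∈ l, N cs g (cs.simple i) = 0) →
      cs.length (g * cs.wordProd l) = cs.length g + l.length := by
  induction l with
  | nil => simp
  | cons a l ih =>
    intro g hg
    rw [List.nodup_cons] at hn
    have h1 := ih hn.2 (fun i hi j hj => hc i (by simp [hi]) j (by simp [hj])) (g * cs.simple a) (by
      intro i hi
      rw [N_mul_simple cs (by rintro rfl; exact hn.1 hi) (hc a (by simp) i (by simp [hi]))]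
      exact hg i (by simp [hi]))
    rw [cs.wordProd_cons, ← mul_assoc, h1]
    have h2 := hg a (by simp)
    have h3 : ¬ cs.IsRightDescent g a := fun h => (N_simple_iff cs g a).mpr h h2
    rw [cs.not_isRightDescent_iff] at h3
    rw [h3, List.length_cons]
    omega

lemma length_down {l : List B} (hn : l.Nodup)
    (hc : ∀ i ∈ l, ∀ j ∈ l, Commute (cs.simple i) (cs.simple j)) :
    ∀ g : W, (∀ i ∈ l, N cs g (cs.simple i) ≠ 0) →
      cs.length (g * cs.wordProd l) + l.length = cs.length g := by
  induction l with
  | nil => simp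
  | cons a l ih =>
    intro g hg
    rw [List.nodup_cons] at hn
    have h1 := ih hn.2 (fun i hi j hj => hc i (by simp [hi]) j (by simp [hj])) (g * cs.simple a) (by
      intro i hi
      rw [N_mul_simple cs (by rintro rfl; exact hn.1 hi) (hc a (by simp) i (by simp [hi]))]
      exact hg i (by simp [hi]))
    rw [cs.wordProd_cons, ← mul_assoc]
    have h2 := hg a (by simp)
    have h3 : cs.IsRightDescent g a := (N_simple_iff cs g a).mp h2
    rw [cs.isRightDescent_iff] at h3
    rw [List.length_cons]
    omega

lemma perm_wordProd {l l' : List B} (hc : ∀ i ∈ l, ∀ j ∈ l, Commute (cs.simple i) (cs.simple j))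
    (h : l.Perm l') : cs.wordProd l = cs.wordProd l' := by
  refine (h.map _).prod_eq' ?_
  rw [List.pairwise_map]
  exact List.pairwise_of_forall_mem_list hc

section auto
variable (σ : B ≃ B) (τ : W ≃* W) (hτ : ∀ i, τ (cs.simple i) = cs.simple (σ i))
include hτ

lemma tau_word (l : List B) : τ (cs.wordProd l) = cs.wordProd (l.map σ) := by
  simp only [CoxeterSystem.wordProd, map_list_prod, List.map_map]
  congr 2
  funext i
  exact hτ i

lemma tau_length_le (w : W) : cs.length (τ w) ≤ cs.length w := by
  obtain ⟨l, hl, rfl⟩ := cs.exists_isReduced w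
  rw [tau_word cs σ τ hτ, hl.eq]
  exact (cs.length_wordProd_le _).trans (by simp)

lemma tau_length (w : W) : cs.length (τ w) = cs.length w := by
  apply le_antisymm (tau_length_le cs σ τ hτ w)
  have := tau_length_le cs σ.symm τ.symm (fun i => by
    rw [MulEquiv.symm_apply_eq, hτ, Equiv.apply_symm_apply]) (τ w)
  simpa using this

lemma tau_iter (n : ℕ) {u : W} (hu : τ u = u) {i j : B}
    (h : u * cs.simple i * u⁻¹ = cs.simple j) :
    u * cs.simple (σ^[n] i) * u⁻¹ = cs.simple (σ^[n] j) := by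
  induction n with
  | zero => exact h
  | succ n ih =>
    have := congrArg τ ih
    simp only [map_mul, map_inv, hu, hτ] at this
    rw [Function.iterate_succ_apply', Function.iterate_succ_apply', this]

lemma N_tau {g : W} (hg : τ g = g) (n : ℕ) {i : B} :
    N cs g (cs.simple (σ^[n] i)) ≠ 0 ↔ N cs g (cs.simple i) ≠ 0 := by
  induction n with
  | zero => rfl
  | succ n ih =>
    rw [← ih, Function.iterate_succ_apply', N_simple_iff, N_simple_iff, ← hτ,
      ← tau_length cs σ τ hτ (g * cs.simple (σ^[n] i)), map_mul, hg]

variable {O : Type w} (orb : O → Finset B)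
    (hcomm : ∀ i j, (∃ n : ℕ, σ^[n] i = j) → Commute (cs.simple i) (cs.simple j))
    (hpart : ∀ i : B, ∃! o : O, i ∈ orb o)
    (hne : ∀ o, (orb o).Nonempty)
    (horb : ∀ o, ∀ i ∈ orb o, ∀ j : B, (j ∈ orb o ↔ ∃ n : ℕ, σ^[n] i = j))

omit hτ in
/-- The folded simple reflection. -/
noncomputable def T (o : O) : W := cs.wordProd (orb o).toList

include hcomm horb

omit hτ in
lemma block_comm (o : O) : ∀ i ∈ (orb o).toList, ∀ j ∈ (orb o).toList,
    Commute (cs.simple i) (cs.simple j) := by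
  intro i hi j hj
  rw [Finset.mem_toList] at hi hj
  exact hcomm i j ((horb o i hi j).mp hj)

lemma tau_T (o : O) : τ (T cs orb o) = T cs orb o := by
  rw [T, tau_word cs σ τ hτ]
  symm
  apply perm_wordProd cs (block_comm cs σ orb hcomm horb o)
  symm
  have hn : ((orb o).toList.map σ).Nodup := (orb o).nodup_toList.map σ.injective
  apply (List.subperm_of_subset hn ?_).perm_of_length_le (by simp)
  intro j hj
  obtain ⟨i, hi, rfl⟩ := List.mem_map.mp hj
  rw [Finset.mem_toList] at hi ⊢
  exact (horb o i hi _).mpr ⟨1, rfl⟩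

omit hτ in
lemma T_sq (o : O) : T cs orb o * T cs orb o = 1 := by
  have h := perm_wordProd cs (block_comm cs σ orb hcomm horb o) (List.reverse_perm _).symm
  rw [cs.wordProd_reverse] at h
  nth_rewrite 1 [T]
  rw [h, T, inv_mul_cancel]

lemma T_step {g : W} (hg : τ g = g) (o : O) {i : B} (hi : i ∈ orb o) :
    (N cs g (cs.simple i) = 0 ∧ cs.length (g * T cs orb o) = cs.length g + (orb o).card) ∨
    (N cs g (cs.simple i) ≠ 0 ∧ cs.length (g * T cs orb o) + (orb o).card = cs.length g) := by
  have key : ∀ j ∈ (orb o).toList, (N cs g (cs.simple j) ≠ 0 ↔ N cs g (cs.simple i) ≠ 0) := by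
    intro j hj
    rw [Finset.mem_toList, horb o i hi] at hj
    obtain ⟨n, rfl⟩ := hj
    exact N_tau cs σ τ hτ hg n
  by_cases h : N cs g (cs.simple i) = 0
  · left
    refine ⟨h, ?_⟩
    rw [T, length_up cs (orb o).nodup_toList (block_comm cs σ orb hcomm horb o) g,
      Finset.length_toList]
    intro j hj
    by_contra h2
    exact (key j hj).mp h2 h
  · right
    refine ⟨h, ?_⟩
    rw [T, ← Finset.length_toList,
      length_down cs (orb o).nodup_toList (block_comm cs σ orb hcomm horb o) g]
    intro j hj
    exact (key j hj).mpr h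

omit hτ in
lemma N_T_word {ω : List O} {x : W} (h : N cs (ω.map (T cs orb)).prod x ≠ 0) :
    ∃ ω₁ o' ω₂, ∃ j ∈ orb o', ω = ω₁ ++ o' :: ω₂ ∧
      (ω₂.map (T cs orb)).prod * x * ((ω₂.map (T cs orb)).prod)⁻¹ = cs.simple j := by
  induction ω with
  | nil => simp [N_one] at h
  | cons o ω ih =>
    rw [List.map_cons, List.prod_cons, N_mul] at h
    by_cases h1 : N cs (ω.map (T cs orb)).prod x = 0
    · rw [h1, zero_add] at h
      obtain ⟨j, hj, h2⟩ := N_block cs (block_comm cs σ orb hcomm horb o) h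
      exact ⟨[], o, ω, j, Finset.mem_toList.mp hj, rfl, h2⟩
    · obtain ⟨ω₁, o', ω₂, j, hj, rfl, h3⟩ := ih h1
      exact ⟨o :: ω₁, o', ω₂, j, hj, rfl, h3⟩

lemma T_conj {u : W} (hu : τ u = u) {o o' : O} {i j : B} (hi : i ∈ orb o) (hj : j ∈ orb o')
    (h : u * cs.simple i * u⁻¹ = cs.simple j) :
    u * T cs orb o * u⁻¹ = T cs orb o' ∧ (orb o').card = (orb o).card := by
  have hp : (((orb o).toList.map cs.simple).map (MulAut.conj u)).Perm
      ((orb o').toList.map cs.simple) := by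
    rw [List.perm_ext_iff_of_nodup]
    · intro x
      simp only [List.map_map, List.mem_map, Finset.mem_toList, Function.comp, MulAut.conj_apply]
      constructor
      · rintro ⟨k, hk, rfl⟩
        obtain ⟨n, rfl⟩ := (horb o i hi k).mp hk
        exact ⟨σ^[n] j, (horb o' j hj _).mpr ⟨n, rfl⟩, (tau_iter cs σ τ hτ n hu h).symm⟩
      · rintro ⟨k, hk, rfl⟩
        obtain ⟨n, rfl⟩ := (horb o' j hj k).mp hk
        exact ⟨σ^[n] i, (horb o i hi _).mpr ⟨n, rfl⟩, tau_iter cs σ τ hτ n hu h⟩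
    · exact ((orb o).nodup_toList.map (simple_inj cs)).map (MulAut.conj u).injective
    · exact (orb o').nodup_toList.map (simple_inj cs)
  constructor
  · have := hp.symm.prod_eq' (by
      rw [List.pairwise_map]
      exact List.pairwise_of_forall_mem_list (block_comm cs σ orb hcomm horb o'))
    rw [← map_list_prod, MulAut.conj_apply] at this
    exact this.symm
  · simpa using hp.length_eq.symm

include hpart hne

/-- The folded system satisfies the abstract conditions. -/
lemma fold_data :
    Fold (G := fixedSubgroup τ) (O := O)
      (fun o => ⟨T cs orb o, tau_T cs σ τ hτ orb hcomm horb o⟩)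
      (fun g => cs.length (g : W)) (fun o => (orb o).card) where
  sq := fun o => Subtype.ext (T_sq cs σ orb hcomm horb o)
  inj := by
    intro o o' h
    have h1 : T cs orb o = T cs orb o' := congrArg Subtype.val h
    obtain ⟨i, hi⟩ := hne o
    have hT := tau_T cs σ τ hτ orb hcomm horb o
    have h2 : N cs (T cs orb o) (cs.simple i) ≠ 0 := by
      rcases T_step cs σ τ hτ orb hcomm horb hT o hi with h2 | h2
      · have := h2.2
        rw [T_sq cs σ orb hcomm horb, cs.length_one] at this
        have := Finset.card_pos.mpr ⟨i, hi⟩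
        omega
      · exact h2.1
    rw [h1] at h2
    obtain ⟨j, hj, h3⟩ := N_block cs (block_comm cs σ orb hcomm horb o') h2
    have := simple_inj cs h3
    subst this
    exact (hpart i).unique hi (Finset.mem_toList.mp hj)
  cpos := fun o => Finset.card_pos.mpr (hne o)
  L1 := cs.length_one
  Linv := fun g => cs.length_inv g
  step := by
    intro g o
    obtain ⟨i, hi⟩ := hne o
    rcases T_step cs σ τ hτ orb hcomm horb g.2 o hi with h | h
    · exact Or.inl h.2
    · exact Or.inr h.2
  exch := by
    intro ω o h
    have hco : ∀ ω : List O, (((ω.map (fun o => (⟨T cs orb o,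
        tau_T cs σ τ hτ orb hcomm horb o⟩ : fixedSubgroup τ))).prod : fixedSubgroup τ) : W) =
        (ω.map (T cs orb)).prod := by
      intro ω
      rw [Subgroup.val_list_prod, List.map_map]
      rfl
    obtain ⟨i, hi⟩ := hne o
    have h1 : N cs (ω.map (T cs orb)).prod (cs.simple i) ≠ 0 := by
      have h2 := T_step cs σ τ hτ orb hcomm horb (ω.map (fun o => (⟨T cs orb o,
        tau_T cs σ τ hτ orb hcomm horb o⟩ : fixedSubgroup τ))).prod.2 o hi
      simp only [Subgroup.coe_mul, hco] at h h2
      rcases h2 with h2 | h2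
      · omega
      · exact h2.1
    obtain ⟨ω₁, o', ω₂, j, hj, rfl, h3⟩ := N_T_word cs σ orb hcomm horb h1
    have hu : τ (ω₂.map (T cs orb)).prod = (ω₂.map (T cs orb)).prod := by
      rw [← hco]; exact (ω₂.map (fun o => (⟨T cs orb o,
        tau_T cs σ τ hτ orb hcomm horb o⟩ : fixedSubgroup τ))).prod.2
    obtain ⟨h4, h5⟩ := T_conj cs σ τ hτ orb hcomm horb hu hi hj h3
    refine ⟨ω₁, o', ω₂, rfl, ?_, h5⟩
    apply Subtype.ext
    rw [Subgroup.coe_mul, hco, hco]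
    simp only [List.map_append, List.map_cons, List.prod_append, List.prod_cons]
    rw [← h4]
    have := T_sq cs σ orb hcomm horb o
    simp only [mul_assoc, inv_mul_cancel_left, this, mul_one]
  gen := by
    have key : ∀ n, ∀ g : fixedSubgroup τ, cs.length (g : W) = n →
        ∃ ω : List O, (ω.map (fun o => (⟨T cs orb o,
        tau_T cs σ τ hτ orb hcomm horb o⟩ : fixedSubgroup τ))).prod = g := by
      intro n
      induction n using Nat.strong_induction_on with
      | _ n ih =>
      intro g hg
      by_cases h : (g : W) = 1
      · exact ⟨[], Subtype.ext (by simp [h])⟩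
      obtain ⟨i, hi⟩ := cs.exists_rightDescent_of_ne_one h
      obtain ⟨o, ho, -⟩ := hpart i
      have h1 := (N_simple_iff cs _ _).mpr hi
      rcases T_step cs σ τ hτ orb hcomm horb g.2 o ho with h2 | h2
      · exact absurd h2.1 h1
      · have := Finset.card_pos.mpr ⟨i, ho⟩
        obtain ⟨ω, hω⟩ := ih _ (by rw [Subgroup.coe_mul]; dsimp only; omega) (g * ⟨T cs orb o,
          tau_T cs σ τ hτ orb hcomm horb o⟩) rfl
        refine ⟨ω ++ [o], ?_⟩
        rw [List.map_append, List.prod_append, hω]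
        apply Subtype.ext
        simp [mul_assoc, T_sq cs σ orb hcomm horb o]
    exact fun g => key _ g rfl

end auto
end FoldingAux

/-- Folding a finite simply laced Coxeter group along a diagram automorphism `σ`
(no two vertices of a `σ`-orbit adjacent, so that the simple reflections in each
orbit commute): the fixed subgroup `W^σ` of the induced automorphism `τ` of `W` is a
Coxeter group whose simple reflections are the products `s_ō = ∏_{i ∈ ō} s_i` over
the `σ`-orbits `ō`, and for `w ∈ W^σ` with a reduced word `s_{ō₁} ⋯ s_{ō_m}` (with
respect to this Coxeter structure), the length of `w` in `W` is `∑_{k=1}^m |ō_k|`.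
Here the orbits are encoded by a type `O` and a map `orb` sending each `o : O` to
the corresponding (nonempty) orbit of `σ`, these orbits partitioning `B`. -/
theorem folding_length {B W : Type*} [Group W] [Fintype B] [DecidableEq B]
    {M : CoxeterMatrix B} (cs : CoxeterSystem M W)
    (σ : B ≃ B) (hσM : ∀ i j, M.M (σ i) (σ j) = M.M i j)
    (hnonadj : ∀ i j, i ≠ j → (∃ n : ℕ, σ^[n] i = j) → M.M i j = 2)
    (hcomm : ∀ i j, (∃ n : ℕ, σ^[n] i = j) → Commute (cs.simple i) (cs.simple j))
    (τ : W ≃* W) (hτ : ∀ i, τ (cs.simple i) = cs.simple (σ i))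
    (O : Type*) (orb : O → Finset B)
    (hpart : ∀ i : B, ∃! o : O, i ∈ orb o)
    (hne : ∀ o, (orb o).Nonempty)
    (horb : ∀ o, ∀ i ∈ orb o, ∀ j : B, (j ∈ orb o ↔ ∃ n : ℕ, σ^[n] i = j)) :
    ∃ (M' : CoxeterMatrix O) (cs' : CoxeterSystem M' (fixedSubgroup τ)),
      (∀ o : O, ((cs'.simple o : W) =
        (orb o).noncommProd (fun i => cs.simple i)
          (fun a ha b hb _ =>
            hcomm a b ((horb o a (Finset.mem_coe.mp ha) b).mp (Finset.mem_coe.mp hb))))) ∧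
      (∀ (w : fixedSubgroup τ) (ω' : List O),
        cs'.IsReduced ω' → cs'.wordProd ω' = w →
        cs.length (w : W) = (ω'.map fun o => (orb o).card).sum) := by
  have F := FoldingAux.fold_data cs σ τ hτ orb hcomm hpart hne horb
  obtain ⟨M', cs', h1, h2⟩ := F.main
  refine ⟨M', cs', fun o => ?_, fun w ω' hω hw => ?_⟩
  · rw [h1]
    have h3 := Finset.noncommProd_toFinset (orb o).toList cs.simple (by
      intro a ha b hb _
      simp only [Finset.toList_toFinset] at ha hb
      exact hcomm a b ((horb o a ha b).mp hb)) (orb o).nodup_toList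
    simp only [Finset.toList_toFinset] at h3
    exact h3.symm
  · rw [← hw]
    exact h2 ω' hω
end
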